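/- Let 𝐀 be a regular BBL transformation of bandwidth (p,q) on V_d^S, set σ = dτ − dim Ker 𝐀, let F_L^− = {Ψ ∈ M_{L,∞} : (P_{L,∞}T)^k Ψ = 0 for some k} and F_R^+ = {Ψ ∈ M_{−∞,R} : (P_{−∞,R}T⁻¹)^k Ψ = 0 for some k}, and let L ≤ R be finite with N = R − L + 1 ≥ 2σ + τ. Then the bulk solution space decomposes as a direct sum M_{L,R} = P_{L,R} Ker 𝐀 ⊕ F_L^− ⊕ F_R^+. -/

import Mathlib

noncomputable section

/-- The space of doubly-infinite sequences with values in `ℂ^d`. -/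
abbrev SeqSp (d : ℕ) : Type := ℤ → Fin d → ℂ

/-- The shift `(Ψ_j)_j ↦ (Ψ_{j+n})_j`; for `n = 1` this is the left shift `T`. -/
def shiftBy (d : ℕ) (n : ℤ) : Module.End ℂ (SeqSp d) where
  toFun Ψ := fun j => Ψ (j + n)
  map_add' _ _ := rfl
  map_smul' _ _ := rfl

/-- Entrywise multiplication of a sequence by a fixed `d × d` matrix. -/
def matOp (d : ℕ) (m : Matrix (Fin d) (Fin d) ℂ) : Module.End ℂ (SeqSp d) where
  toFun Ψ := fun j => m.mulVec (Ψ j)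
  map_add' Ψ Φ := by funext j; simp [Matrix.mulVec_add]
  map_smul' c Ψ := by funext j; simp [Matrix.mulVec_smul]

/-- The banded block-Laurent (BBL) transformation `(𝐀Ψ)_j = ∑_{r=p}^{q} a_r ψ_{j+r}`. -/
def bbl (d : ℕ) (a : ℤ → Matrix (Fin d) (Fin d) ℂ) (p q : ℤ) : Module.End ℂ (SeqSp d) :=
  ∑ r ∈ Finset.Icc p q, matOp d (a r) * shiftBy d r

/-- The projection `P_S` replacing every entry with index outside `S` by zero. -/
def projOn (d : ℕ) (S : Set ℤ) : Module.End ℂ (SeqSp d) where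
  toFun Ψ := fun j => S.indicator Ψ j
  map_add' Ψ Φ := by
    funext j
    by_cases h : j ∈ S <;> simp [Set.indicator_apply, h]
  map_smul' c Ψ := by
    funext j
    by_cases h : j ∈ S <;> simp [Set.indicator_apply, h]

/-- The window `{j : ℤ | Lb ≤ j ≤ Rb}`, with possibly infinite endpoints. -/
def windowSet (Lb : WithBot ℤ) (Rb : WithTop ℤ) : Set ℤ :=
  {j : ℤ | Lb ≤ (j : WithBot ℤ) ∧ (j : WithTop ℤ) ≤ Rb}

/-- Sequences supported in `S` (vanishing at every index outside `S`): the space `V_{L,R}`. -/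
def suppIn (d : ℕ) (S : Set ℤ) : Submodule ℂ (SeqSp d) where
  carrier := {Ψ | ∀ j ∉ S, Ψ j = 0}
  add_mem' := by
    intro Ψ Φ hΨ hΦ j hj
    simp [Pi.add_apply, hΨ j hj, hΦ j hj]
  zero_mem' := fun j _ => rfl
  smul_mem' := by
    intro c Ψ hΨ j hj
    simp [Pi.smul_apply, hΨ j hj]

/-- Sequences vanishing at every index of `S`. -/
def vanishOn (d : ℕ) (S : Set ℤ) : Submodule ℂ (SeqSp d) where
  carrier := {Ψ | ∀ j ∈ S, Ψ j = 0}
  add_mem' := by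
    intro Ψ Φ hΨ hΦ j hj
    simp [Pi.add_apply, hΨ j hj, hΦ j hj]
  zero_mem' := fun j _ => rfl
  smul_mem' := by
    intro c Ψ hΨ j hj
    simp [Pi.smul_apply, hΨ j hj]

/-- The bulk solution space `M_{Lb,Rb} = Ker (P_{Lb−p',Rb−q'} 𝐀 |_{V_{Lb,Rb}})`, viewed as a
submodule of the full sequence space: sequences supported in the window `[Lb,Rb]` whose image
under `𝐀` vanishes on the bulk window `[Lb−p', Rb−q']` (with `p' = min p 0`, `q' = max q 0`). -/
def bulkSol (d : ℕ) (a : ℤ → Matrix (Fin d) (Fin d) ℂ) (p q : ℤ)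
    (Lb : WithBot ℤ) (Rb : WithTop ℤ) : Submodule ℂ (SeqSp d) :=
  suppIn d (windowSet Lb Rb) ⊓
    (vanishOn d (windowSet (Lb + ((-min p 0 : ℤ) : WithBot ℤ))
        (Rb + ((-max q 0 : ℤ) : WithTop ℤ)))).comap (bbl d a p q)

/-- Falling-factorial type product `j^{(v)} = (j−v+1)(j−v+2)⋯j`. -/
def ff (j : ℤ) (v : ℕ) : ℤ := ∏ i ∈ Finset.range v, (j - i)

/-- The scalar sequence `Φ_{z,v}`, with `j`-th entry `j^{(v−1)} z^{j−v+1}`, and `Φ_{z,0} = 0`. -/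
def Phi (z : ℂ) (v : ℕ) : ℤ → ℂ :=
  fun j => if v = 0 then 0 else (ff j (v - 1) : ℂ) * z ^ (j - (v : ℤ) + 1)

/-- The vector sequence `Φ_{z,v}|m⟩`. -/
def PhiVec (d : ℕ) (z : ℂ) (v : ℕ) (m : Fin d) : SeqSp d :=
  fun j => Phi z v j • (Pi.single m 1 : Fin d → ℂ)

/-- The subspace `T_{z,s} = Span{Φ_{z,v}|m⟩ : 1 ≤ v ≤ s, 1 ≤ m ≤ d}`. -/
def Tspace (d : ℕ) (z : ℂ) (s : ℕ) : Submodule ℂ (SeqSp d) :=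
  Submodule.span ℂ {Ψ : SeqSp d | ∃ v ∈ Finset.Icc 1 s, ∃ m : Fin d, Ψ = PhiVec d z v m}

/-- The symbol `A(w,w⁻¹) = ∑_{r=p}^q w^r a_r` as a matrix of Laurent polynomials. -/
def symbol (d : ℕ) (a : ℤ → Matrix (Fin d) (Fin d) ℂ) (p q : ℤ) :
    Matrix (Fin d) (Fin d) (LaurentPolynomial ℂ) :=
  ∑ r ∈ Finset.Icc p q, (LaurentPolynomial.T r : LaurentPolynomial ℂ) • (a r).map (fun c => LaurentPolynomial.C c)

/-- The evaluation `A(z,z⁻¹) = ∑_{r=p}^q z^r a_r` of the symbol at `z ≠ 0`. -/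
def symbolEval (d : ℕ) (a : ℤ → Matrix (Fin d) (Fin d) ℂ) (p q : ℤ) (z : ℂ) :
    Matrix (Fin d) (Fin d) ℂ :=
  ∑ r ∈ Finset.Icc p q, z ^ r • a r

/-- The `k`-th derivative `A^{(k)}(z,z⁻¹) = ∑_{r=p}^q r(r−1)⋯(r−k+1) z^{r−k} a_r`. -/
def symbolDeriv (d : ℕ) (a : ℤ → Matrix (Fin d) (Fin d) ℂ) (p q : ℤ) (k : ℕ) (z : ℂ) :
    Matrix (Fin d) (Fin d) ℂ :=
  ∑ r ∈ Finset.Icc p q, ((ff r k : ℂ) * z ^ (r - (k : ℤ))) • a r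

/-- The generalized kernel `⋃_k Ker (f^k)` of an endomorphism. -/
def genKer (d : ℕ) (f : Module.End ℂ (SeqSp d)) : Submodule ℂ (SeqSp d) :=
  ⨆ k : ℕ, LinearMap.ker (f ^ k)

/-- `F_L^− `: the generalized kernel of the unilateral shift `P_{L,∞}T` on `M_{L,∞}`. -/
def Fminus (d : ℕ) (a : ℤ → Matrix (Fin d) (Fin d) ℂ) (p q : ℤ) (L : ℤ) :
    Submodule ℂ (SeqSp d) :=
  bulkSol d a p q (L : WithBot ℤ) ⊤ ⊓
    genKer d (projOn d (windowSet (L : WithBot ℤ) ⊤) * shiftBy d 1)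

/-- `F_R^+`: the generalized kernel of the shift `P_{−∞,R}T⁻¹` on `M_{−∞,R}`. -/
def Fplus (d : ℕ) (a : ℤ → Matrix (Fin d) (Fin d) ℂ) (p q : ℤ) (R : ℤ) :
    Submodule ℂ (SeqSp d) :=
  bulkSol d a p q ⊥ (R : WithTop ℤ) ⊓
    genKer d (projOn d (windowSet ⊥ (R : WithTop ℤ)) * shiftBy d (-1))

/-- The left shift on scalar sequences. -/
def shiftS : Module.End ℂ (ℤ → ℂ) where
  toFun φ := fun j => φ (j + 1)
  map_add' _ _ := rfl
  map_smul' _ _ := rfl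

/-- The linear map on `SeqSp d` induced by a diagonal matrix polynomial with diagonal entries
`g m`: it acts on the `m`-th component of a sequence as `g m` evaluated at the left shift. -/
def diagPolyOp (d : ℕ) (g : Fin d → Polynomial ℂ) : Module.End ℂ (SeqSp d) where
  toFun Ψ := fun j m => Polynomial.aeval shiftS (g m) (fun i => Ψ i m) j
  map_add' Ψ Φ := by
    funext j m
    show Polynomial.aeval shiftS (g m) ((fun i => Ψ i m) + (fun i => Φ i m)) j = _
    rw [map_add]
    rfl
  map_smul' c Ψ := by
    funext j m
    show Polynomial.aeval shiftS (g m) (c • (fun i => Ψ i m)) j = _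
    rw [map_smul]
    rfl

/-- The subspace of sequences with values in `Span{|m⟩ : d₀ < m ≤ d}` (the range of `ρ_d(π)`). -/
def piRange (d d₀ : ℕ) : Submodule ℂ (SeqSp d) where
  carrier := {Ψ | ∀ j : ℤ, ∀ m : Fin d, (m : ℕ) < d₀ → Ψ j m = 0}
  add_mem' := by
    intro Ψ Φ hΨ hΦ j m hm
    simp [Pi.add_apply, hΨ j m hm, hΦ j m hm]
  zero_mem' := fun j m _ => rfl
  smul_mem' := by
    intro c Ψ hΨ j m hm
    simp [Pi.smul_apply, hΨ j m hm]

/-- The Hilbert space `H` of square-summable half-infinite sequences, as a subspace of `SeqSp d`: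
sequences vanishing at indices `j ≤ 0` whose restriction to `j ≥ 1` is in `ℓ²`. -/
def Hspace (d : ℕ) : Submodule ℂ (SeqSp d) where
  carrier := {Ψ | (∀ j : ℤ, j ≤ 0 → Ψ j = 0) ∧ Memℓp (fun n : ℕ => Ψ ((n : ℤ) + 1)) 2}
  add_mem' := by
    intro Ψ Φ hΨ hΦ
    refine ⟨fun j hj => by simp [Pi.add_apply, hΨ.1 j hj, hΦ.1 j hj], ?_⟩
    exact hΨ.2.add hΦ.2
  zero_mem' := ⟨fun j _ => rfl, zero_memℓp⟩
  smul_mem' := by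
    intro c Ψ hΨ
    exact ⟨fun j hj => by simp [Pi.smul_apply, hΨ.1 j hj], hΨ.2.const_smul c⟩


/-- The embedding of Laurent polynomials into Laurent series sending `T n` to `X ^ (-n)`, so that
multiplication by the image of `T n` shifts coefficients to the left by `n`. -/
def laurentToSeries : LaurentPolynomial ℂ →ₐ[ℂ] LaurentSeries ℂ :=
  AddMonoidAlgebra.lift ℂ (LaurentSeries ℂ) ℤ
    { toFun := fun n => HahnSeries.single (-n.toAdd) 1
      map_one' := by simp
      map_mul' := fun m n => by simp [HahnSeries.single_mul_single, add_comm] }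

theorem laurentToSeries_C_mul_T (c : ℂ) (n : ℤ) :
    laurentToSeries (LaurentPolynomial.C c * LaurentPolynomial.T n) = HahnSeries.single (-n) c := by
  rw [← LaurentPolynomial.single_eq_C_mul_T]
  refine (AddMonoidAlgebra.lift_single _ _ _).trans ?_
  rw [Algebra.smul_def, LaurentSeries.algebraMap_apply]
  change HahnSeries.single 0 c * HahnSeries.single (-n) 1 = _
  rw [HahnSeries.single_mul_single, zero_add, mul_one]

theorem coeff_laurentToSeries (f : LaurentPolynomial ℂ) (j : ℤ) :
    (laurentToSeries f).coeff j = f.coeff (-j) := by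
  induction f using LaurentPolynomial.induction_on' with
  | add f g hf hg => simp [hf, hg]
  | C_mul_T n c =>
    rw [laurentToSeries_C_mul_T, ← LaurentPolynomial.single_eq_C_mul_T,
      AddMonoidAlgebra.coeff_single]
    rcases eq_or_ne j (-n) with rfl | h
    · simp
    · rw [HahnSeries.coeff_single_of_ne h, Finsupp.single_eq_of_ne (by omega)]

theorem laurentToSeries_injective : Function.Injective laurentToSeries := by
  intro f g h
  ext j
  have := congrArg (fun x : LaurentSeries ℂ => x.coeff (-j)) h
  simpa [coeff_laurentToSeries] using this

theorem bbl_apply (d : ℕ) (a : ℤ → Matrix (Fin d) (Fin d) ℂ) (p q : ℤ) (Ψ : SeqSp d) (j : ℤ) :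
    bbl d a p q Ψ j = ∑ r ∈ Finset.Icc p q, (a r).mulVec (Ψ (j + r)) := by
  simp [bbl, LinearMap.sum_apply, Finset.sum_apply, matOp, shiftBy]

theorem coeff_symbol_mulVec (d : ℕ) (a : ℤ → Matrix (Fin d) (Fin d) ℂ) (p q : ℤ)
    (x : Fin d → LaurentSeries ℂ) (m : Fin d) (j : ℤ) :
    ((((symbol d a p q).map laurentToSeries).mulVec x) m).coeff j =
      bbl d a p q (fun i n => (x n).coeff i) j m := by
  have h : ∀ n, laurentToSeries (symbol d a p q m n) =
      ∑ r ∈ Finset.Icc p q, HahnSeries.single (-r) (a r m n) := by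
    intro n
    rw [symbol, Matrix.sum_apply, map_sum]
    refine Finset.sum_congr rfl fun r _ => ?_
    rw [← laurentToSeries_C_mul_T, mul_comm]
    simp
  simp only [Matrix.mulVec, dotProduct, Matrix.map_apply, h, bbl_apply, Finset.sum_apply,
    Finset.sum_mul, HahnSeries.coeff_sum, HahnSeries.coeff_single_mul, sub_neg_eq_add]
  exact Finset.sum_comm

theorem exists_series_coeff (d : ℕ) (Ψ : SeqSp d) (l : ℤ) (h : ∀ j < l, Ψ j = 0) :
    ∃ x : Fin d → LaurentSeries ℂ, ∀ n j, (x n).coeff j = Ψ j n := by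
  refine ⟨fun n => HahnSeries.ofSuppBddBelow (fun j => Ψ j n) ⟨l, fun j hj => ?_⟩,
    fun n j => congrFun HahnSeries.coeff_ofSuppBddBelow j⟩
  by_contra! hlt
  exact hj (by simp [h j hlt])

theorem exists_coeff_eq_zero (d : ℕ) (x : Fin d → LaurentSeries ℂ) :
    ∃ l : ℤ, ∀ j < l, (fun n => (x n).coeff j) = 0 := by
  obtain ⟨l, hl⟩ := (Set.finite_range fun n => (x n).order).bddBelow
  refine ⟨l, fun j hj => funext fun n => ?_⟩
  exact HahnSeries.coeff_eq_zero_of_lt_order (hj.trans_le (hl ⟨n, rfl⟩))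

theorem det_symbol_series_ne_zero (d : ℕ) (a : ℤ → Matrix (Fin d) (Fin d) ℂ) (p q : ℤ)
    (hreg : (symbol d a p q).det ≠ 0) : ((symbol d a p q).map laurentToSeries).det ≠ 0 := by
  intro h
  refine hreg (laurentToSeries_injective ?_)
  rw [AlgHom.map_det, map_zero]
  exact h

theorem bbl_eq_zero_of_left_bounded (d : ℕ) (a : ℤ → Matrix (Fin d) (Fin d) ℂ) (p q : ℤ)
    (hreg : (symbol d a p q).det ≠ 0) (l : ℤ) (Ψ : SeqSp d) (h : ∀ j < l, Ψ j = 0)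
    (h0 : bbl d a p q Ψ = 0) : Ψ = 0 := by
  obtain ⟨x, hx⟩ := exists_series_coeff d Ψ l h
  have hx' : (fun i n => (x n).coeff i) = Ψ := by ext; simp [hx]
  have : x = 0 := by
    refine Matrix.mulVec_injective_of_det_ne_zero (det_symbol_series_ne_zero d a p q hreg) ?_
    rw [Matrix.mulVec_zero]
    ext m j
    rw [coeff_symbol_mulVec, hx', h0]
    simp
  ext j n
  simp [← hx, this]

theorem exists_bbl_eq_of_left_bounded (d : ℕ) (a : ℤ → Matrix (Fin d) (Fin d) ℂ) (p q : ℤ)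
    (hreg : (symbol d a p q).det ≠ 0) (l : ℤ) (U : SeqSp d) (h : ∀ j < l, U j = 0) :
    ∃ X : SeqSp d, (∃ l', ∀ j < l', X j = 0) ∧ bbl d a p q X = U := by
  obtain ⟨u, hu⟩ := exists_series_coeff d U l h
  have hunit := (Matrix.isUnit_iff_isUnit_det _).2
    (det_symbol_series_ne_zero d a p q hreg).isUnit
  obtain ⟨x, hx⟩ := Matrix.mulVec_surjective_iff_isUnit.2 hunit u
  refine ⟨fun i n => (x n).coeff i, exists_coeff_eq_zero d x, ?_⟩
  ext j m
  rw [← coeff_symbol_mulVec, hx, hu]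

/-- The reflection `(Ψ_j)_j ↦ (Ψ_{-j})_j`. -/
def reflect (d : ℕ) : SeqSp d ≃ₗ[ℂ] SeqSp d :=
  LinearEquiv.funCongrLeft ℂ (Fin d → ℂ) (Equiv.neg ℤ)

@[simp]
theorem reflect_apply (d : ℕ) (Ψ : SeqSp d) (j : ℤ) : reflect d Ψ j = Ψ (-j) := rfl

@[simp]
theorem reflect_reflect (d : ℕ) (Ψ : SeqSp d) : reflect d (reflect d Ψ) = Ψ := by
  ext j
  simp

/-- The conjugate of an operator by the reflection. -/
def reflectOp (d : ℕ) (A : Module.End ℂ (SeqSp d)) : Module.End ℂ (SeqSp d) :=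
  (reflect d).toLinearMap ∘ₗ A ∘ₗ (reflect d).toLinearMap

theorem reflectOp_apply (d : ℕ) (A : Module.End ℂ (SeqSp d)) (Ψ : SeqSp d) :
    reflectOp d A Ψ = reflect d (A (reflect d Ψ)) := rfl

theorem finrank_ker_reflectOp (d : ℕ) (A : Module.End ℂ (SeqSp d)) :
    Module.finrank ℂ (LinearMap.ker (reflectOp d A)) = Module.finrank ℂ (LinearMap.ker A) := by
  suffices h : (LinearMap.ker (reflectOp d A)).map (reflect d).toLinearMap = LinearMap.ker A by
    rw [← h]
    exact (LinearEquiv.finrank_map_eq (reflect d) _).symm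
  ext Ψ
  simp only [Submodule.mem_map, LinearMap.mem_ker, reflectOp_apply, LinearEquiv.coe_coe]
  constructor
  · rintro ⟨Φ, hΦ, rfl⟩
    simpa using hΦ
  · intro h
    exact ⟨reflect d Ψ, by simp [h], reflect_reflect d Ψ⟩

theorem reflectOp_bbl (d : ℕ) (a : ℤ → Matrix (Fin d) (Fin d) ℂ) (p q : ℤ) :
    reflectOp d (bbl d a p q) = bbl d (fun r => a (-r)) (-q) (-p) := by
  ext Ψ j : 2
  rw [reflectOp_apply, reflect_apply, bbl_apply, bbl_apply]
  refine Finset.sum_nbij' (fun r => -r) (fun r => -r) ?_ ?_ ?_ ?_ ?_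
  · intro r hr
    simp only [Finset.mem_Icc] at hr ⊢
    omega
  · intro r hr
    simp only [Finset.mem_Icc] at hr ⊢
    omega
  · simp
  · simp
  · intro r _
    simp only [reflect_apply, neg_neg]
    congr 2
    ring

theorem det_symbol_neg_ne_zero (d : ℕ) (a : ℤ → Matrix (Fin d) (Fin d) ℂ) (p q : ℤ)
    (hreg : (symbol d a p q).det ≠ 0) : (symbol d (fun r => a (-r)) (-q) (-p)).det ≠ 0 := by
  have h : symbol d (fun r => a (-r)) (-q) (-p) =
      (symbol d a p q).map (LaurentPolynomial.invert (R := ℂ)) := by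
    ext1 m n
    simp only [symbol, Matrix.sum_apply, Matrix.map_apply, map_sum, Matrix.smul_apply,
      smul_eq_mul, map_mul, LaurentPolynomial.invert_T, LaurentPolynomial.invert_C]
    refine Finset.sum_nbij' (fun r => -r) (fun r => -r) ?_ ?_ ?_ ?_ ?_
    · intro r hr
      simp only [Finset.mem_Icc] at hr ⊢
      omega
    · intro r hr
      simp only [Finset.mem_Icc] at hr ⊢
      omega
    · simp
    · simp
    · simp
  intro h0
  refine hreg (LaurentPolynomial.invert.injective ?_)
  rw [map_zero, AlgEquiv.map_det, ← h0, h]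
  rfl

/-- A translation-invariant operator whose `j`-th output depends only on the entries with index in
`[j + P, j + Q]`, and which is bijective on left-bounded and on right-bounded sequences. -/
structure IsRegularBanded (d : ℕ) (A : Module.End ℂ (SeqSp d)) (P Q : ℤ) : Prop where
  le : P ≤ Q
  congr : ∀ (Ψ Φ : SeqSp d) (j : ℤ), (∀ i, j + P ≤ i → i ≤ j + Q → Ψ i = Φ i) → A Ψ j = A Φ j
  shift : ∀ (n : ℤ) (Ψ : SeqSp d) (j : ℤ), A (shiftBy d n Ψ) j = A Ψ (j + n)
  inj_left : ∀ (l : ℤ) (Ψ : SeqSp d), (∀ j < l, Ψ j = 0) → A Ψ = 0 → Ψ = 0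
  inj_right : ∀ (l : ℤ) (Ψ : SeqSp d), (∀ j > l, Ψ j = 0) → A Ψ = 0 → Ψ = 0
  surj_left : ∀ (l : ℤ) (U : SeqSp d), (∀ j < l, U j = 0) →
    ∃ X : SeqSp d, (∃ l', ∀ j < l', X j = 0) ∧ A X = U
  surj_right : ∀ (l : ℤ) (U : SeqSp d), (∀ j > l, U j = 0) →
    ∃ X : SeqSp d, (∃ l', ∀ j > l', X j = 0) ∧ A X = U

theorem isRegularBanded_bbl (d : ℕ) (a : ℤ → Matrix (Fin d) (Fin d) ℂ) (p q : ℤ)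
    (hreg : (symbol d a p q).det ≠ 0) :
    IsRegularBanded d (bbl d a p q) (min p 0) (max q 0) where
  le := (min_le_right p 0).trans (le_max_right q 0)
  congr Ψ Φ j h := by
    rw [bbl_apply, bbl_apply]
    refine Finset.sum_congr rfl fun r hr => ?_
    rw [Finset.mem_Icc] at hr
    rw [h (j + r) (by omega) (by omega)]
  shift n Ψ j := by
    rw [bbl_apply, bbl_apply]
    refine Finset.sum_congr rfl fun r _ => ?_
    rw [add_right_comm j n r]
    rfl
  inj_left l Ψ := bbl_eq_zero_of_left_bounded d a p q hreg l Ψ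
  inj_right l Ψ h h0 := by
    refine (reflect d).injective ((bbl_eq_zero_of_left_bounded d (fun r => a (-r)) (-q) (-p)
      (det_symbol_neg_ne_zero d a p q hreg) (-l) _ ?_ ?_).trans (map_zero _).symm)
    · intro j hj
      exact h (-j) (by omega)
    · rw [← reflectOp_bbl, reflectOp_apply, reflect_reflect, h0, map_zero]
  surj_left l U := exists_bbl_eq_of_left_bounded d a p q hreg l U
  surj_right l U h := by
    obtain ⟨X, ⟨l', hl'⟩, hX⟩ := exists_bbl_eq_of_left_bounded d (fun r => a (-r)) (-q) (-p)
      (det_symbol_neg_ne_zero d a p q hreg) (-l) (reflect d U)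
      fun j hj => h (-j) (by omega)
    refine ⟨reflect d X, ⟨-l', fun j hj => hl' (-j) (by omega)⟩, (reflect d).injective ?_⟩
    rw [← hX, ← reflectOp_bbl, reflectOp_apply]

namespace IsRegularBanded

variable {d : ℕ} {A : Module.End ℂ (SeqSp d)} {P Q : ℤ}

theorem reflectOp (hA : IsRegularBanded d A P Q) :
    IsRegularBanded d (reflectOp d A) (-Q) (-P) where
  le := neg_le_neg hA.le
  congr Ψ Φ j h := by
    refine hA.congr _ _ (-j) fun i h₁ h₂ => h (-i) ?_ ?_ <;> omega
  shift n Ψ j := by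
    have h : reflect d (shiftBy d n Ψ) = shiftBy d (-n) (reflect d Ψ) := by
      ext i : 1
      change Ψ (-i + n) = Ψ (-(i + -n))
      congr 1
      ring
    rw [reflectOp_apply, reflectOp_apply, reflect_apply, reflect_apply, h, hA.shift, neg_add]
  inj_left l Ψ h h0 := by
    refine (reflect d).injective ((hA.inj_right (-l) _ (fun j hj => h (-j) (by omega)) ?_).trans
      (map_zero _).symm)
    exact (reflect d).injective (h0.trans (map_zero _).symm)
  inj_right l Ψ h h0 := by
    refine (reflect d).injective ((hA.inj_left (-l) _ (fun j hj => h (-j) (by omega)) ?_).trans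
      (map_zero _).symm)
    exact (reflect d).injective (h0.trans (map_zero _).symm)
  surj_left l U h := by
    obtain ⟨X, ⟨l', hl'⟩, hX⟩ := hA.surj_right (-l) (reflect d U) fun j hj => h (-j) (by omega)
    refine ⟨reflect d X, ⟨-l', fun j hj => hl' (-j) (by omega)⟩, ?_⟩
    rw [reflectOp_apply, reflect_reflect, hX, reflect_reflect]
  surj_right l U h := by
    obtain ⟨X, ⟨l', hl'⟩, hX⟩ := hA.surj_left (-l) (reflect d U) fun j hj => h (-j) (by omega)
    refine ⟨reflect d X, ⟨-l', fun j hj => hl' (-j) (by omega)⟩, ?_⟩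
    rw [reflectOp_apply, reflect_reflect, hX, reflect_reflect]

theorem apply_eq_zero (hA : IsRegularBanded d A P Q) (Ψ : SeqSp d) (j : ℤ)
    (h : ∀ i, j + P ≤ i → i ≤ j + Q → Ψ i = 0) : A Ψ j = 0 := by
  rw [hA.congr Ψ 0 j h, map_zero, Pi.zero_apply]

theorem eq_zero_of_mem_ker (hA : IsRegularBanded d A P Q) {Ψ : SeqSp d} (h : A Ψ = 0)
    {x y : ℤ} (hxy : Q - P ≤ y - x + 1) (h0 : ∀ j, x ≤ j → j ≤ y → Ψ j = 0) : Ψ = 0 := by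
  have hle := hA.le
  let Φ : SeqSp d := fun j => if y < j then Ψ j else 0
  have hΦ : A Φ = 0 := by
    ext1 j
    rcases le_or_gt x (j + P) with hj | hj
    · rw [hA.congr Φ Ψ j fun i h₁ h₂ => ?_, h]
      by_cases hi : y < i
      · exact if_pos hi
      · rw [h0 i (by omega) (by omega)]
        exact if_neg hi
    · exact hA.apply_eq_zero _ _ fun i h₁ h₂ => if_neg (by omega)
  have hΦ0 : Φ = 0 := hA.inj_left y Φ (fun j hj => if_neg (by omega)) hΦ
  refine hA.inj_right y Ψ (fun j hj => ?_) h
  have := congrFun hΦ0 j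
  rwa [show Φ j = Ψ j from if_pos hj] at this

end IsRegularBanded

/-- Extension by zero of a sequence given on a finite set of indices. -/
def extendZero (d : ℕ) (S : Finset ℤ) : (S → Fin d → ℂ) →ₗ[ℂ] SeqSp d where
  toFun f := fun j => if h : j ∈ S then f ⟨j, h⟩ else 0
  map_add' f g := by
    ext1 j
    by_cases h : j ∈ S <;> simp [h]
  map_smul' c f := by
    ext1 j
    by_cases h : j ∈ S <;> simp [h]

theorem extendZero_of_mem {d : ℕ} {S : Finset ℤ} (f : S → Fin d → ℂ) {j : ℤ} (h : j ∈ S) :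
    extendZero d S f j = f ⟨j, h⟩ := dif_pos h

theorem extendZero_of_notMem {d : ℕ} {S : Finset ℤ} (f : S → Fin d → ℂ) {j : ℤ} (h : j ∉ S) :
    extendZero d S f j = 0 := dif_neg h

namespace IsRegularBanded

variable {d : ℕ} {A : Module.End ℂ (SeqSp d)} {P Q : ℤ}

theorem finrank_le (hA : IsRegularBanded d A P Q) {L R : ℤ} (hLR : Q - P ≤ R - L + 1)
    {E : Type*} [AddCommGroup E] [Module ℂ E] (H : E →ₗ[ℂ] SeqSp d)
    (hbulk : ∀ e j, L - P ≤ j → j ≤ R - Q → A (H e) j = 0)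
    (hinj : ∀ e, (∀ j, L ≤ j → j ≤ R → H e j = 0) → e = 0) :
    Module.Finite ℂ E ∧ (Module.finrank ℂ E : ℤ) ≤ d * (Q - P) := by
  have hle := hA.le
  let res (S : Finset ℤ) : SeqSp d →ₗ[ℂ] (S → Fin d → ℂ) :=
    LinearMap.funLeft ℂ (Fin d → ℂ) (Subtype.val : S → ℤ)
  let G := res (Finset.Icc (L - P) (R - Q)) ∘ₗ A ∘ₗ extendZero d (Finset.Icc L R)
  have hG : ∀ (X : SeqSp d) (j : Finset.Icc (L - P) (R - Q)),
      G (res (Finset.Icc L R) X) j = A X j := by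
    intro X j
    have hj := Finset.mem_Icc.1 j.2
    refine hA.congr _ _ _ fun i h₁ h₂ => ?_
    rw [extendZero_of_mem _ (Finset.mem_Icc.2 ⟨by omega, by omega⟩)]
    rfl
  have hsurj : Function.Surjective G := by
    intro g
    obtain ⟨X, -, hX⟩ := hA.surj_left (L - P) (extendZero d _ g) fun j hj =>
      extendZero_of_notMem _ (by simp only [Finset.mem_Icc]; omega)
    refine ⟨res _ X, funext fun j => ?_⟩
    rw [hG, hX, extendZero_of_mem _ j.2]
  have hrank := LinearMap.finrank_range_add_finrank_ker G
  rw [LinearMap.range_eq_top.2 hsurj, finrank_top] at hrank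
  simp only [Module.finrank_pi_fintype, Module.finrank_self, Finset.sum_const, Finset.card_univ,
    Fintype.card_coe, Int.card_Icc, Fintype.card_fin, smul_eq_mul, mul_one] at hrank
  have hker : (Module.finrank ℂ (LinearMap.ker G) : ℤ) = d * (Q - P) := by
    zify at hrank
    rw [Int.toNat_of_nonneg (by omega), Int.toNat_of_nonneg (by omega)] at hrank
    linarith
  let F : E →ₗ[ℂ] LinearMap.ker G :=
      LinearMap.codRestrict _ (res (Finset.Icc L R) ∘ₗ H) fun e => by
    rw [LinearMap.mem_ker]
    ext1 j
    have hj := Finset.mem_Icc.1 j.2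
    exact (hG (H e) j).trans (hbulk e j hj.1 hj.2)
  have hF : Function.Injective F := by
    rw [← LinearMap.ker_eq_bot, LinearMap.ker_eq_bot']
    intro e he
    refine hinj e fun j h₁ h₂ => ?_
    exact congrFun (congrArg Subtype.val he) ⟨j, Finset.mem_Icc.2 ⟨h₁, h₂⟩⟩
  refine ⟨Module.Finite.of_injective F hF, ?_⟩
  rw [← hker]
  exact_mod_cast LinearMap.finrank_le_finrank_of_injective hF

theorem finrank_ker_le (hA : IsRegularBanded d A P Q) :
    Module.Finite ℂ (LinearMap.ker A) ∧ (Module.finrank ℂ (LinearMap.ker A) : ℤ) ≤ d * (Q - P) :=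
  hA.finrank_le (L := 1) (R := Q - P) (by omega) (LinearMap.ker A).subtype
    (fun e j _ _ => congrFun e.2 j)
    fun e he => Subtype.ext (hA.eq_zero_of_mem_ker e.2 (by omega) he)

/-- A nonzero entry of a finitely supported solution on a right half-line lies close to the
endpoint: its shifts are independent of each other and of the kernel. -/
theorem eq_zero_of_left_localized (hA : IsRegularBanded d A P Q) {L M : ℤ} {Ψ : SeqSp d}
    (hbulk : ∀ j, L - P ≤ j → A Ψ j = 0) (hM : ∀ j, M ≤ j → Ψ j = 0) (j : ℤ)
    (hj : L + (d * (Q - P) - Module.finrank ℂ (LinearMap.ker A)) ≤ j) : Ψ j = 0 := by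
  have hle := hA.le
  have hker := hA.finrank_ker_le
  have := hker.1
  by_contra hne
  obtain ⟨m, ⟨hjm, hm⟩, hmax⟩ : ∃ m, (j ≤ m ∧ Ψ m ≠ 0) ∧ ∀ i, j ≤ i ∧ Ψ i ≠ 0 → i ≤ m :=
    Int.exists_greatest_of_bdd ⟨M, fun i hi => by
      by_contra! h
      exact hi.2 (hM i h.le)⟩ ⟨j, le_rfl, hne⟩
  have htop : ∀ i, m < i → Ψ i = 0 := fun i hi => by
    by_contra h
    have := hmax i ⟨by omega, h⟩
    omega
  obtain ⟨n, hn⟩ : ∃ n : ℕ, (n : ℤ) = m - L + 1 := ⟨(m - L + 1).toNat, by omega⟩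
  let S : (Fin n → ℂ) →ₗ[ℂ] SeqSp d :=
    Fintype.linearCombination ℂ fun i : Fin n => shiftBy d (i : ℤ) Ψ
  have hS : ∀ c j, S c j = ∑ i, c i • Ψ (j + (i : ℕ)) := fun c j => by
    simp [S, Fintype.linearCombination_apply, Finset.sum_apply, shiftBy]
  have hAS : ∀ c j, A (S c) j = ∑ i, c i • A Ψ (j + (i : ℕ)) := fun c j => by
    simp [S, Fintype.linearCombination_apply, Finset.sum_apply, hA.shift]
  have hbound := (hA.finrank_le (L := L) (R := m + (Q - P)) (by omega)
    (S.coprod (LinearMap.ker A).subtype) ?_ ?_).2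
  · simp only [Module.finrank_prod, Module.finrank_fin_fun, Nat.cast_add] at hbound
    omega
  · rintro ⟨c, k⟩ i hi _
    simp only [LinearMap.coprod_apply, map_add, Submodule.subtype_apply, Pi.add_apply]
    rw [LinearMap.mem_ker.1 k.2, hAS, Finset.sum_eq_zero, Pi.zero_apply, add_zero]
    intro r _
    rw [hbulk _ (by omega), smul_zero]
  · rintro ⟨c, k⟩ h
    simp only [LinearMap.coprod_apply, Submodule.subtype_apply, Pi.add_apply] at h
    have hk : k = 0 := by
      refine Subtype.ext (hA.eq_zero_of_mem_ker k.2 (x := m + 1) (y := m + (Q - P)) (by omega) ?_)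
      intro i h₁ h₂
      have hi := h i (by omega) h₂
      rwa [hS, Finset.sum_eq_zero, zero_add] at hi
      intro r _
      rw [htop _ (by omega), smul_zero]
    subst hk
    have hc : ∀ (r : ℕ) (hr : r < n), c ⟨r, hr⟩ = 0 := by
      intro r
      induction r using Nat.strong_induction_on with
      | _ r ih =>
        intro hr
        have hi := h (m - r) (by omega) (by omega)
        rw [hS, Finset.sum_eq_single ⟨r, hr⟩] at hi
        · simpa [hm] using hi
        · intro s _ hs
          rcases lt_or_ge (s : ℕ) r with hlt | hge
          · rw [ih s hlt s.2, zero_smul]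
          · have : (s : ℕ) ≠ r := fun h => hs (Fin.ext h)
            rw [htop _ (by omega), smul_zero]
        · simp
    ext r
    · exact hc r r.2
    · rfl

theorem eq_zero_of_right_localized (hA : IsRegularBanded d A P Q) {R M : ℤ} {Ψ : SeqSp d}
    (hbulk : ∀ j, j ≤ R - Q → A Ψ j = 0) (hM : ∀ j, j ≤ M → Ψ j = 0) (j : ℤ)
    (hj : j ≤ R - (d * (Q - P) - Module.finrank ℂ (LinearMap.ker A))) : Ψ j = 0 := by
  have h := hA.reflectOp.eq_zero_of_left_localized (L := -R) (M := -M) (Ψ := reflect d Ψ)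
    (fun i hi => ?_) (fun i hi => hM (-i) (by omega)) (-j) ?_
  · simpa using h
  · rw [reflectOp_apply, reflect_reflect]
    exact hbulk (-i) (by omega)
  · rw [finrank_ker_reflectOp, show -P - -Q = Q - P by ring]
    omega

end IsRegularBanded

theorem mem_windowSet_coe (L R j : ℤ) :
    j ∈ windowSet (L : WithBot ℤ) (R : WithTop ℤ) ↔ L ≤ j ∧ j ≤ R := by
  simp [windowSet]

theorem mem_windowSet_top (L j : ℤ) : j ∈ windowSet (L : WithBot ℤ) ⊤ ↔ L ≤ j := by
  simp [windowSet]

theorem mem_windowSet_bot (R j : ℤ) : j ∈ windowSet ⊥ (R : WithTop ℤ) ↔ j ≤ R := by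
  simp [windowSet]

theorem projOn_of_mem {d : ℕ} {S : Set ℤ} (Ψ : SeqSp d) {j : ℤ} (h : j ∈ S) :
    projOn d S Ψ j = Ψ j := Set.indicator_of_mem h Ψ

theorem projOn_of_notMem {d : ℕ} {S : Set ℤ} (Ψ : SeqSp d) {j : ℤ} (h : j ∉ S) :
    projOn d S Ψ j = 0 := Set.indicator_of_notMem h Ψ

section BulkSolutions

variable {d : ℕ} {a : ℤ → Matrix (Fin d) (Fin d) ℂ} {p q : ℤ} {Ψ : SeqSp d}

theorem mem_bulkSol_coe {L R : ℤ} :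
    Ψ ∈ bulkSol d a p q (L : WithBot ℤ) (R : WithTop ℤ) ↔
      (∀ j, ¬(L ≤ j ∧ j ≤ R) → Ψ j = 0) ∧
        ∀ j, L - min p 0 ≤ j → j ≤ R - max q 0 → bbl d a p q Ψ j = 0 := by
  rw [bulkSol, ← WithBot.coe_add, ← WithTop.coe_add]
  simp only [Submodule.mem_inf, Submodule.mem_comap, suppIn, vanishOn, Submodule.mem_mk,
    AddSubmonoid.mem_mk, AddSubsemigroup.mem_mk, Set.mem_ofPred_eq, mem_windowSet_coe,
    ← sub_eq_add_neg, and_imp]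

theorem mem_bulkSol_top {L : ℤ} :
    Ψ ∈ bulkSol d a p q (L : WithBot ℤ) ⊤ ↔
      (∀ j < L, Ψ j = 0) ∧ ∀ j, L - min p 0 ≤ j → bbl d a p q Ψ j = 0 := by
  rw [bulkSol, ← WithBot.coe_add, top_add]
  simp only [Submodule.mem_inf, Submodule.mem_comap, suppIn, vanishOn, Submodule.mem_mk,
    AddSubmonoid.mem_mk, AddSubsemigroup.mem_mk, Set.mem_ofPred_eq, mem_windowSet_top,
    ← sub_eq_add_neg, not_le]

theorem mem_bulkSol_bot {R : ℤ} :
    Ψ ∈ bulkSol d a p q ⊥ (R : WithTop ℤ) ↔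
      (∀ j > R, Ψ j = 0) ∧ ∀ j, j ≤ R - max q 0 → bbl d a p q Ψ j = 0 := by
  rw [bulkSol, ← WithTop.coe_add, WithBot.bot_add]
  simp only [Submodule.mem_inf, Submodule.mem_comap, suppIn, vanishOn, Submodule.mem_mk,
    AddSubmonoid.mem_mk, AddSubsemigroup.mem_mk, Set.mem_ofPred_eq, mem_windowSet_bot,
    ← sub_eq_add_neg, not_le, gt_iff_lt]

theorem mem_genKer {f : Module.End ℂ (SeqSp d)} : Ψ ∈ genKer d f ↔ ∃ k, (f ^ k) Ψ = 0 :=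
  Submodule.mem_iSup_of_chain (LinearMap.iterateKer f) Ψ

theorem projOn_shift_pow_apply {S : Set ℤ} {s : ℤ} (hS : ∀ j ∈ S, j + s ∈ S)
    (h : ∀ j ∉ S, Ψ j = 0) (k : ℕ) (j : ℤ) :
    (((projOn d S * shiftBy d s) ^ k) Ψ) j = S.indicator (fun i => Ψ (i + k * s)) j := by
  induction k generalizing j with
  | zero =>
    by_cases hj : j ∈ S
    · simp [hj]
    · simp [hj, h j hj]
  | succ k ih =>
    rw [pow_succ', Module.End.mul_apply, Module.End.mul_apply]
    by_cases hj : j ∈ S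
    · rw [projOn_of_mem _ hj, Set.indicator_of_mem hj]
      change (((projOn d S * shiftBy d s) ^ k) Ψ) (j + s) = _
      rw [ih, Set.indicator_of_mem (hS j hj)]
      push_cast
      congr 1
      ring
    · rw [projOn_of_notMem _ hj, Set.indicator_of_notMem hj]

theorem mem_Fminus {L : ℤ} :
    Ψ ∈ Fminus d a p q L ↔ (∀ j < L, Ψ j = 0) ∧
      (∀ j, L - min p 0 ≤ j → bbl d a p q Ψ j = 0) ∧ ∃ M, ∀ j, M ≤ j → Ψ j = 0 := by
  rw [Fminus, Submodule.mem_inf, mem_bulkSol_top, mem_genKer, and_assoc]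
  refine and_congr_right fun hL => and_congr_right fun _ => ?_
  have hpow := projOn_shift_pow_apply (S := windowSet (L : WithBot ℤ) ⊤) (s := 1) (Ψ := Ψ)
    (fun j hj => by rw [mem_windowSet_top] at hj ⊢; omega)
    (fun j hj => hL j (by rwa [mem_windowSet_top, not_le] at hj))
  constructor
  · rintro ⟨k, hk⟩
    refine ⟨L + k, fun j hj => ?_⟩
    have := congrFun hk (j - k)
    rw [hpow, Set.indicator_of_mem ((mem_windowSet_top _ _).2 (by omega))] at this
    simpa using this
  · rintro ⟨M, hM⟩
    refine ⟨(M - L).toNat, funext fun j => ?_⟩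
    rw [hpow, Pi.zero_apply]
    refine Set.indicator_apply_eq_zero.2 fun hj => hM _ ?_
    rw [mem_windowSet_top] at hj
    omega

theorem mem_Fplus {R : ℤ} :
    Ψ ∈ Fplus d a p q R ↔ (∀ j > R, Ψ j = 0) ∧
      (∀ j, j ≤ R - max q 0 → bbl d a p q Ψ j = 0) ∧ ∃ M, ∀ j, j ≤ M → Ψ j = 0 := by
  rw [Fplus, Submodule.mem_inf, mem_bulkSol_bot, mem_genKer, and_assoc]
  refine and_congr_right fun hR => and_congr_right fun _ => ?_
  have hpow := projOn_shift_pow_apply (S := windowSet ⊥ (R : WithTop ℤ)) (s := -1) (Ψ := Ψ)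
    (fun j hj => by rw [mem_windowSet_bot] at hj ⊢; omega)
    (fun j hj => hR j (by rwa [mem_windowSet_bot, not_le] at hj))
  constructor
  · rintro ⟨k, hk⟩
    refine ⟨R - k, fun j hj => ?_⟩
    have := congrFun hk (j + k)
    rw [hpow, Set.indicator_of_mem ((mem_windowSet_bot _ _).2 (by omega))] at this
    simpa using this
  · rintro ⟨M, hM⟩
    refine ⟨(R - M).toNat, funext fun j => ?_⟩
    rw [hpow, Pi.zero_apply]
    refine Set.indicator_apply_eq_zero.2 fun hj => hM _ ?_
    rw [mem_windowSet_bot] at hj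
    omega

end BulkSolutions

theorem stmt_13 (d : ℕ) (hd : 1 ≤ d) (p q : ℤ) (hpq : p ≤ q)
    (a : ℤ → Matrix (Fin d) (Fin d) ℂ) (hap : a p ≠ 0) (haq : a q ≠ 0)
    (hreg : (symbol d a p q).det ≠ 0)
    (σ : ℤ) (hσ : σ = d * (max q 0 - min p 0)
        - Module.finrank ℂ ↥(LinearMap.ker (bbl d a p q)))
    (L R : ℤ) (hN : 2 * σ + (max q 0 - min p 0) ≤ R - L + 1) :
    (bulkSol d a p q (L : WithBot ℤ) (R : WithTop ℤ)
        = (LinearMap.ker (bbl d a p q)).map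
              (projOn d (windowSet (L : WithBot ℤ) (R : WithTop ℤ)))
            ⊔ Fminus d a p q L ⊔ Fplus d a p q R) ∧
    Disjoint ((LinearMap.ker (bbl d a p q)).map
        (projOn d (windowSet (L : WithBot ℤ) (R : WithTop ℤ))))
      (Fminus d a p q L) ∧
    Disjoint ((LinearMap.ker (bbl d a p q)).map
          (projOn d (windowSet (L : WithBot ℤ) (R : WithTop ℤ)))
        ⊔ Fminus d a p q L)
      (Fplus d a p q R) := by
  set P := min p 0 with hP
  set Q := max q 0 with hQ
  set W := windowSet (L : WithBot ℤ) (R : WithTop ℤ) with hW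
  have hA : IsRegularBanded d (bbl d a p q) P Q := isRegularBanded_bbl d a p q hreg
  have hle := hA.le
  have hσ0 : 0 ≤ σ := by
    have := hA.finrank_ker_le.2
    omega
  have hminus : ∀ Ψ ∈ Fminus d a p q L, ∀ j, L + σ ≤ j → Ψ j = 0 := by
    intro Ψ hΨ j hj
    obtain ⟨-, hb, M, hM⟩ := mem_Fminus.1 hΨ
    exact hA.eq_zero_of_left_localized hb hM j (by rwa [← hσ])
  have hplus : ∀ Ψ ∈ Fplus d a p q R, ∀ j, j ≤ R - σ → Ψ j = 0 := by
    intro Ψ hΨ j hj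
    obtain ⟨-, hb, M, hM⟩ := mem_Fplus.1 hΨ
    exact hA.eq_zero_of_right_localized hb hM j (by rwa [← hσ])
  have hbulk : ∀ k ∈ LinearMap.ker (bbl d a p q), ∀ f ∈ Fminus d a p q L, ∀ g ∈ Fplus d a p q R,
      projOn d W k + f + g = 0 → projOn d W k = 0 := by
    intro k hk f hf g hg h
    have : k = 0 := hA.eq_zero_of_mem_ker hk (x := L + σ) (y := R - σ) (by omega) fun j h₁ h₂ => by
      have hj := congrFun h j
      simp only [Pi.add_apply, Pi.zero_apply] at hj
      rwa [hminus f hf j h₁, hplus g hg j h₂, add_zero, add_zero,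
        projOn_of_mem _ ((mem_windowSet_coe L R j).2 (by omega))] at hj
    rw [this, map_zero]
  refine ⟨le_antisymm ?_ (sup_le (sup_le ?_ ?_) ?_), ?_, ?_⟩
  · intro Ψ hΨ
    obtain ⟨hsupp, hΨ⟩ := mem_bulkSol_coe.1 hΨ
    let u : SeqSp d := fun j => if j < L - P then bbl d a p q Ψ j else 0
    let v : SeqSp d := fun j => if j < L - P then 0 else bbl d a p q Ψ j
    have huv : u + v = bbl d a p q Ψ := by
      ext1 j
      by_cases h : j < L - P <;> simp [u, v, h]
    have hu : ∀ j, L - P ≤ j → u j = 0 := fun j hj => if_neg (by omega)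
    have hv : ∀ j, j ≤ R - Q → v j = 0 := fun j hj => by
      by_cases h : j < L - P
      · exact if_pos h
      · exact (if_neg h).trans (hΨ j (by omega) hj)
    obtain ⟨X, ⟨l, hl⟩, hX⟩ := hA.surj_right (L - P) u fun j hj => hu j (by omega)
    obtain ⟨Y, ⟨r, hr⟩, hY⟩ := hA.surj_left (R - Q) v fun j hj => hv j (by omega)
    have hf : projOn d (windowSet (L : WithBot ℤ) ⊤) X ∈ Fminus d a p q L := by
      refine mem_Fminus.2 ⟨fun j hj => projOn_of_notMem _ ?_, fun j hj => ?_, l + 1,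
        fun j hj => ?_⟩
      · rw [mem_windowSet_top]
        omega
      · rw [← hu j hj, ← hX]
        refine hA.congr _ _ _ fun i h₁ h₂ => projOn_of_mem _ ?_
        rw [mem_windowSet_top]
        omega
      · exact Set.indicator_apply_eq_zero.2 fun _ => hl j (by omega)
    have hg : projOn d (windowSet ⊥ (R : WithTop ℤ)) Y ∈ Fplus d a p q R := by
      refine mem_Fplus.2 ⟨fun j hj => projOn_of_notMem _ ?_, fun j hj => ?_, r - 1,
        fun j hj => ?_⟩
      · rw [mem_windowSet_bot]
        omega
      · rw [← hv j hj, ← hY]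
        refine hA.congr _ _ _ fun i h₁ h₂ => projOn_of_mem _ ?_
        rw [mem_windowSet_bot]
        omega
      · exact Set.indicator_apply_eq_zero.2 fun _ => hr j (by omega)
    have hk : Ψ - X - Y ∈ LinearMap.ker (bbl d a p q) := by
      rw [LinearMap.mem_ker, map_sub, map_sub, hX, hY, ← huv]
      abel
    have hsum : Ψ = projOn d W (Ψ - X - Y) + projOn d (windowSet (L : WithBot ℤ) ⊤) X +
        projOn d (windowSet ⊥ (R : WithTop ℤ)) Y := by
      ext1 j
      simp only [Pi.add_apply]
      by_cases hj : L ≤ j ∧ j ≤ R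
      · rw [projOn_of_mem _ ((mem_windowSet_coe L R j).2 hj),
          projOn_of_mem _ ((mem_windowSet_top L j).2 hj.1),
          projOn_of_mem _ ((mem_windowSet_bot R j).2 hj.2)]
        simp only [Pi.sub_apply]
        abel
      · rw [hsupp j hj, projOn_of_notMem _ (mt (mem_windowSet_coe L R j).1 hj)]
        rcases lt_or_ge j L with h | h
        · rw [projOn_of_notMem _ (mt (mem_windowSet_top L j).1 (by omega)),
            hplus _ hg j (by omega)]
          simp
        · rw [hminus _ hf j (by omega),
            projOn_of_notMem _ (mt (mem_windowSet_bot R j).1 (by omega))]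
          simp
    rw [hsum]
    exact Submodule.add_mem_sup (Submodule.add_mem_sup (Submodule.mem_map_of_mem hk) hf) hg
  · rintro _ ⟨k, hk, rfl⟩
    refine mem_bulkSol_coe.2 ⟨fun j hj => projOn_of_notMem _ (mt (mem_windowSet_coe L R j).1 hj),
      fun j h₁ h₂ => ?_⟩
    rw [hA.congr _ k j fun i h₁ h₂ => projOn_of_mem _ ?_, LinearMap.mem_ker.1 hk, Pi.zero_apply]
    rw [mem_windowSet_coe]
    omega
  · intro f hf
    obtain ⟨hL, hb, -⟩ := mem_Fminus.1 hf
    refine mem_bulkSol_coe.2 ⟨fun j hj => ?_, fun j h₁ _ => hb j h₁⟩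
    rcases lt_or_ge j L with h | h
    · exact hL j h
    · exact hminus f hf j (by omega)
  · intro g hg
    obtain ⟨hR, hb, -⟩ := mem_Fplus.1 hg
    refine mem_bulkSol_coe.2 ⟨fun j hj => ?_, fun j _ h₂ => hb j h₂⟩
    rcases lt_or_ge R j with h | h
    · exact hR j h
    · exact hplus g hg j (by omega)
  · rw [Submodule.disjoint_def]
    rintro _ ⟨k, hk, rfl⟩ hf
    exact hbulk k hk _ (neg_mem hf) 0 (zero_mem _) (by simp)
  · rw [Submodule.disjoint_def]
    intro Ψ hΨ hg
    obtain ⟨_, ⟨k, hk, rfl⟩, f, hf, rfl⟩ := Submodule.mem_sup.1 hΨ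
    have hk0 := hbulk k hk f hf _ (neg_mem hg) (by abel)
    rw [hk0, zero_add] at hg ⊢
    ext1 j
    rcases le_or_gt (L + σ) j with h | h
    · exact hminus f hf j h
    · rcases le_or_gt j (R - σ) with h' | h'
      · exact hplus f hg j h'
      · omega

end
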